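/- Suppose Assumption A holds and τ ∈ (0,1). Then there is δ′ > 0 such that whenever δ(z,λ) ≤ δ′ (so that A(z,λ) = B), every optimal multiplier λ* ∈ S_λ is feasible for LP(Â) for every subset Â ⊆ A(z,λ); in particular, ‖∇φ(z) + Σ_{i=1}^m λ*_i ∇g_i(z)‖_∞ ≤ η(z,λ)^τ. -/

import Mathlib

open scoped RealInnerProductSpace
open Metric Set

noncomputable section

/-- Euclidean space ℝ^n. -/
abbrev En (n : ℕ) := EuclideanSpace ℝ (Fin n)

/-- The Lagrangian L(z,λ) = φ(z) + λᵀ g(z). -/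
def Lagr {n m : ℕ} (φ : En n → ℝ) (g : Fin m → En n → ℝ) (z : En n) (l : En m) : ℝ :=
  φ z + ∑ i, l i * g i z

/-- ∇_z L(z,λ). -/
def gradL {n m : ℕ} (φ : En n → ℝ) (g : Fin m → En n → ℝ) (l : En m) (z : En n) : En n :=
  gradient (fun z' => Lagr φ g z' l) z

/-- ∇²_{zz} L(z,λ), as a continuous linear map. -/
def hessL {n m : ℕ} (φ : En n → ℝ) (g : Fin m → En n → ℝ) (l : En m) (z : En n) :
    En n →L[ℝ] En n :=
  fderiv ℝ (gradL φ g l) z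

/-- The KKT conditions at a point z with multiplier λ. -/
def KKTat {n m : ℕ} (φ : En n → ℝ) (g : Fin m → En n → ℝ) (z : En n) (l : En m) : Prop :=
  gradL φ g l z = 0 ∧ (∀ i, g i z ≤ 0) ∧ (∀ i, 0 ≤ l i) ∧ ∑ i, l i * g i z = 0

/-- The set S_λ of optimal multipliers at z*. -/
def Slam {n m : ℕ} (φ : En n → ℝ) (g : Fin m → En n → ℝ) (zs : En n) : Set (En m) :=
  {l | KKTat φ g zs l}

/-- The active set B. -/
def ActB {n m : ℕ} (g : Fin m → En n → ℝ) (zs : En n) : Set (Fin m) := {i | g i zs = 0}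

/-- Strongly active constraints B₊. -/
def Bplus {n m : ℕ} (φ : En n → ℝ) (g : Fin m → En n → ℝ) (zs : En n) : Set (Fin m) :=
  {i | g i zs = 0 ∧ ∃ l ∈ Slam φ g zs, 0 < l i}

/-- Weakly active constraints B₀ = B \ B₊. -/
def Bzero {n m : ℕ} (φ : En n → ℝ) (g : Fin m → En n → ℝ) (zs : En n) : Set (Fin m) :=
  ActB g zs \ Bplus φ g zs

/-- Mangasarian–Fromovitz constraint qualification at z*. -/
def MFCQ {n m : ℕ} (g : Fin m → En n → ℝ) (zs : En n) : Prop :=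
  ∃ y : En n, ∀ i ∈ ActB g zs, ⟪gradient (g i) zs, y⟫ < 0

/-- The second-order sufficient condition. -/
def SOC {n m : ℕ} (φ : En n → ℝ) (g : Fin m → En n → ℝ) (zs : En n) : Prop :=
  ∃ σ : ℝ, 0 < σ ∧ ∀ l ∈ Slam φ g zs, ∀ w : En n,
    (∀ i ∈ Bplus φ g zs, ⟪gradient (g i) zs, w⟫ = 0) →
    (∀ i ∈ Bzero φ g zs, ⟪gradient (g i) zs, w⟫ ≤ 0) →
    σ * ‖w‖ ^ 2 ≤ ⟪w, hessL φ g l zs w⟫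

/-- φ and g twice Lipschitz continuously differentiable near z*. -/
def Smooth2 {n m : ℕ} (φ : En n → ℝ) (g : Fin m → En n → ℝ) (zs : En n) : Prop :=
  ∃ U ∈ nhds zs, ContDiffOn ℝ 2 φ U ∧ (∀ i, ContDiffOn ℝ 2 (g i) U) ∧
    ∃ K : NNReal, LipschitzOnWith K (fun z => fderiv ℝ (fderiv ℝ φ) z) U ∧
      ∀ i, LipschitzOnWith K (fun z => fderiv ℝ (fderiv ℝ (g i)) z) U

/-- Assumption A: smoothness, KKT, MFCQ and the second-order condition hold at z*. -/
def AssumpA {n m : ℕ} (φ : En n → ℝ) (g : Fin m → En n → ℝ) (zs : En n) : Prop :=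
  Smooth2 φ g zs ∧ (∃ l : En m, KKTat φ g zs l) ∧ MFCQ g zs ∧ SOC φ g zs

/-- δ(z,λ) = dist((z,λ), S) where S = {z*} × S_λ (Euclidean product norm). -/
def deltaP {n m : ℕ} (φ : En n → ℝ) (g : Fin m → En n → ℝ) (zs : En n)
    (z : En n) (l : En m) : ℝ :=
  Real.sqrt (‖z - zs‖ ^ 2 + (Metric.infDist l (Slam φ g zs)) ^ 2)

/-- η(z,λ) = ‖(∇_z L(z,λ), min(λ, −g(z)))‖. -/
def eta {n m : ℕ} (φ : En n → ℝ) (g : Fin m → En n → ℝ) (z : En n) (l : En m) : ℝ :=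
  Real.sqrt (‖gradL φ g l z‖ ^ 2 + ∑ i, (min (l i) (-(g i z))) ^ 2)

/-- The estimated active set A(z,λ) = {i : g_i(z) ≥ −η(z,λ)^τ}. -/
def Aest {n m : ℕ} (φ : En n → ℝ) (g : Fin m → En n → ℝ) (τ : ℝ) (z : En n) (l : En m) :
    Set (Fin m) :=
  {i | -(eta φ g z l) ^ τ ≤ g i z}

/-- Feasibility for the linear program LP(Â) (independent of Â): componentwise bounds on
∇φ(z) + Σ_i λ̃_i ∇g_i(z), nonnegativity on A(z,λ), and λ̃_i = 0 off A(z,λ). -/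
def LPFeasible {n m : ℕ} (φ : En n → ℝ) (g : Fin m → En n → ℝ) (τ : ℝ)
    (z : En n) (l : En m) (lt : En m) : Prop :=
  (∀ j : Fin n, |(gradient φ z + ∑ i, lt i • gradient (g i) z) j| ≤ (eta φ g z l) ^ τ) ∧
  (∀ i ∈ Aest φ g τ z l, 0 ≤ lt i) ∧ (∀ i ∉ Aest φ g τ z l, lt i = 0)

/-- The objective Σ_{i ∈ Â} λ̃_i of LP(Â). -/
def lpObj {m : ℕ} (Ah : Set (Fin m)) (lt : En m) : ℝ :=
  ∑ i, Ah.indicator (fun i => lt i) i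

/-- λ̃ is an optimal solution of LP(Â). -/
def LPOptimal {n m : ℕ} (φ : En n → ℝ) (g : Fin m → En n → ℝ) (τ : ℝ)
    (z : En n) (l : En m) (Ah : Set (Fin m)) (lt : En m) : Prop :=
  LPFeasible φ g τ z l lt ∧ ∀ lt', LPFeasible φ g τ z l lt' → lpObj Ah lt' ≤ lpObj Ah lt

/-- The initial working set Â_init of Procedure ID0. -/
def initSet {n m : ℕ} (φ : En n → ℝ) (g : Fin m → En n → ℝ) (τ th : ℝ)
    (z : En n) (l : En m) : Set (Fin m) :=
  Aest φ g τ z l \ {i | (eta φ g z l) ^ th ≤ l i}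

/-- One pass of the repeat loop of Procedure ID0 that does not stop:
an optimal solution λ̃ of LP(Â) is chosen, C = {i ∈ Â : λ̃_i ≥ η^τ̂} is nonempty,
and the working set is updated to Â \ C. -/
def ID0Step {n m : ℕ} (φ : En n → ℝ) (g : Fin m → En n → ℝ) (τ th : ℝ)
    (z : En n) (l : En m) (Ah Ah' : Set (Fin m)) : Prop :=
  ∃ lt, LPOptimal φ g τ z l Ah lt ∧
    {i | i ∈ Ah ∧ (eta φ g z l) ^ th ≤ lt i} ≠ ∅ ∧
    Ah' = Ah \ {i | i ∈ Ah ∧ (eta φ g z l) ^ th ≤ lt i}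

/-- (A₀, A₊) is a possible output of Procedure ID0 on input (z,λ). -/
def ID0Out {n m : ℕ} (φ : En n → ℝ) (g : Fin m → En n → ℝ) (τ th : ℝ)
    (z : En n) (l : En m) (A0 Ap : Set (Fin m)) : Prop :=
  ∃ Ah : Set (Fin m),
    Relation.ReflTransGen (ID0Step φ g τ th z l) (initSet φ g τ th z l) Ah ∧
    ((∃ lt, LPOptimal φ g τ z l Ah lt ∧
        {i | i ∈ Ah ∧ (eta φ g z l) ^ th ≤ lt i} = ∅ ∧
        A0 = Ah ∧ Ap = Aest φ g τ z l \ Ah) ∨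
     (∃ lt, LPOptimal φ g τ z l Ah lt ∧
        {i | i ∈ Ah ∧ (eta φ g z l) ^ th ≤ lt i} ≠ ∅ ∧
        Ah \ {i | i ∈ Ah ∧ (eta φ g z l) ^ th ≤ lt i} = ∅ ∧
        A0 = ∅ ∧ Ap = Aest φ g τ z l))

/-- Feasibility for the linear program (intlam). -/
def IntFeasible {n m : ℕ} (φ : En n → ℝ) (g : Fin m → En n → ℝ) (τ : ℝ)
    (z : En n) (l : En m) (Ap : Set (Fin m)) (t : ℝ) (lh : En m) : Prop :=
  (∀ i ∈ Ap, t ≤ lh i) ∧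
  (∀ j : Fin n, |(gradient φ z + ∑ i, lh i • gradient (g i) z) j| ≤ (eta φ g z l) ^ τ) ∧
  (∀ i ∈ Ap, 0 ≤ lh i) ∧ (∀ i ∉ Ap, lh i = 0)

/-- (t̂, λ̂) is an optimal solution of (intlam). -/
def IntOptimal {n m : ℕ} (φ : En n → ℝ) (g : Fin m → En n → ℝ) (τ : ℝ)
    (z : En n) (l : En m) (Ap : Set (Fin m)) (t : ℝ) (lh : En m) : Prop :=
  IntFeasible φ g τ z l Ap t lh ∧
  ∀ t' lh', IntFeasible φ g τ z l Ap t' lh' → t' ≤ t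

/-- ε_λ = max_{λ* ∈ S_λ} min_{i ∈ B₊} λ*_i. -/
def epsLam {n m : ℕ} (φ : En n → ℝ) (g : Fin m → En n → ℝ) (zs : En n) : ℝ :=
  ⨆ l ∈ Slam φ g zs, ⨅ i ∈ Bplus φ g zs, l i

/-- S_λ^ν = {λ ∈ S_λ : min_{i∈B₊} λ_i ≥ ν ε_λ}. -/
def SlamNu {n m : ℕ} (φ : En n → ℝ) (g : Fin m → En n → ℝ) (zs : En n) (ν : ℝ) :
    Set (En m) :=
  {l ∈ Slam φ g zs | ∀ i ∈ Bplus φ g zs, ν * epsLam φ g zs ≤ l i}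

/-- (Δz, λ⁺) solves the stabilized SQP subproblem at (z,λ) with parameter μ. -/
def SSQPSol {n m : ℕ} (φ : En n → ℝ) (g : Fin m → En n → ℝ)
    (z : En n) (l : En m) (μ : ℝ) (dz : En n) (lp : En m) : Prop :=
  hessL φ g l z dz + gradient φ z + ∑ i, lp i • gradient (g i) z = 0 ∧
  (∀ i, 0 ≤ lp i) ∧
  (∀ i, g i z + ⟪gradient (g i) z, dz⟫ - μ * (lp i - l i) ≤ 0) ∧
  ∑ i, lp i * (g i z + ⟪gradient (g i) z, dz⟫ - μ * (lp i - l i)) = 0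

/-- Euclidean distance between primal-dual pairs. -/
def pdist {n m : ℕ} (p q : En n × En m) : ℝ :=
  Real.sqrt (‖p.1 - q.1‖ ^ 2 + ‖p.2 - q.2‖ ^ 2)

open Filter Topology

theorem euclidean_norm_le_of_abs_le {m : ℕ} {u w : En m} (h : ∀ i, |u i| ≤ |w i|) :
    ‖u‖ ≤ ‖w‖ := by
  rw [EuclideanSpace.norm_eq, EuclideanSpace.norm_eq]
  refine Real.sqrt_le_sqrt (Finset.sum_le_sum fun i _ => ?_)
  exact pow_le_pow_left₀ (norm_nonneg _) (h i) 2

theorem euclidean_norm_le_sum_abs {m : ℕ} (u : En m) : ‖u‖ ≤ ∑ i, |u i| := by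
  rw [EuclideanSpace.norm_eq]
  refine Real.sqrt_le_iff.2 ⟨Finset.sum_nonneg fun i _ => abs_nonneg _, ?_⟩
  exact Finset.sum_sq_le_sq_sum_of_nonneg fun i _ => abs_nonneg _

/-- A continuous linear map with trivial kernel on a sign orthant is bounded below there. -/
theorem exists_norm_le_on_orthant {m : ℕ} {F : Type*} [NormedAddCommGroup F] [NormedSpace ℝ F]
    (A : En m →L[ℝ] F) (σ : Fin m → SignType)
    (hker : ∀ u : En m, (∀ i, u i = σ i * |u i|) → A u = 0 → u = 0) :
    ∃ C : ℝ, ∀ u : En m, (∀ i, u i = σ i * |u i|) → ‖u‖ ≤ C * ‖A u‖ := by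
  set K : Set (En m) := {u | ∀ i, u i = σ i * |u i|} with hK
  have hKc : IsClosed K := by
    simp only [hK, Set.ofPred_forall]
    exact isClosed_iInter fun i => isClosed_eq (by fun_prop) (by fun_prop)
  have hcomp : IsCompact (sphere (0 : En m) 1 ∩ K) := (isCompact_sphere 0 1).inter_right hKc
  have hnorm : ∀ u ∈ K, u ≠ 0 → (‖u‖⁻¹ • u) ∈ sphere (0 : En m) 1 ∩ K := by
    intro u hu hu0
    refine ⟨by simp [norm_smul, hu0], fun i => ?_⟩
    have h1 : (0 : ℝ) ≤ ‖u‖⁻¹ := by positivity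
    simp only [PiLp.smul_apply, smul_eq_mul, abs_mul, abs_of_nonneg h1]
    rw [mul_left_comm, ← hu i]
  rcases (sphere (0 : En m) 1 ∩ K).eq_empty_or_nonempty with he | hne
  · refine ⟨0, fun u hu => ?_⟩
    by_cases hu0 : u = 0
    · simp [hu0]
    · have := hnorm u hu hu0
      rw [he] at this
      exact this.elim
  · obtain ⟨v, hv, hmin⟩ := hcomp.exists_isMinOn hne
      (f := fun u => ‖A u‖) (by fun_prop)
    have hv0 : 0 < ‖A v‖ := by
      rw [norm_pos_iff]
      intro h
      have h0 := hker v hv.2 h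
      have h1 := hv.1
      simp [h0] at h1
    refine ⟨‖A v‖⁻¹, fun u hu => ?_⟩
    by_cases hu0 : u = 0
    · simp [hu0]
    · have h2 : ‖A v‖ ≤ ‖A (‖u‖⁻¹ • u)‖ := hmin (hnorm u hu hu0)
      rw [map_smul, norm_smul, norm_inv, norm_norm] at h2
      have hup : 0 < ‖u‖ := norm_pos_iff.2 hu0
      rw [inv_mul_eq_div, le_div_iff₀ hv0]
      rw [inv_mul_eq_div, le_div_iff₀ hup] at h2
      linarith

/-- Any vector may be shrunk coordinatewise towards zero, keeping its image under a linear map,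
until its norm is controlled by the norm of that image. -/
theorem exists_conformal_norm_le {m : ℕ} {F : Type*} [NormedAddCommGroup F] [NormedSpace ℝ F]
    (A : En m →L[ℝ] F) :
    ∃ C : ℝ, 0 ≤ C ∧ ∀ w : En m, ∃ w' : En m,
      (∀ i, w' i ∈ uIcc 0 (w i)) ∧ A w' = A w ∧ ‖w'‖ ≤ C * ‖A w‖ := by
  have hσ : ∀ σ : Fin m → SignType, ∃ C : ℝ,
      (∀ u : En m, (∀ i, u i = σ i * |u i|) → A u = 0 → u = 0) →
        ∀ u : En m, (∀ i, u i = σ i * |u i|) → ‖u‖ ≤ C * ‖A u‖ := by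
    intro σ
    by_cases h : ∀ u : En m, (∀ i, u i = σ i * |u i|) → A u = 0 → u = 0
    · obtain ⟨C, hC⟩ := exists_norm_le_on_orthant A σ h
      exact ⟨C, fun _ => hC⟩
    · exact ⟨0, fun h' => (h h').elim⟩
  choose C hC using hσ
  obtain ⟨M, hM⟩ := (Set.finite_range C).bddAbove
  refine ⟨max M 0, le_max_right _ _, fun w => ?_⟩
  set T : Set (En m) := {u | (∀ i, u i ∈ uIcc 0 (w i)) ∧ A u = A w} with hT
  have hTc : IsCompact T := by
    refine Metric.isCompact_of_isClosed_isBounded ?_ ?_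
    · refine IsClosed.inter ?_ (isClosed_eq A.continuous continuous_const)
      have hco : ∀ i, Continuous fun u : En m => u i := fun i => by fun_prop
      have he : {u : En m | ∀ i, u i ∈ uIcc 0 (w i)} =
          ⋂ i, (fun u : En m => u i) ⁻¹' uIcc 0 (w i) := by
        ext u
        simp
      have hcl : IsClosed {u : En m | ∀ i, u i ∈ uIcc 0 (w i)} := by
        rw [he]
        exact isClosed_iInter fun i => isClosed_Icc.preimage (hco i)
      exact hcl
    · refine (Metric.isBounded_closedBall (x := (0 : En m)) (r := ‖w‖)).subset fun u hu => ?_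
      rw [mem_closedBall_zero_iff]
      refine euclidean_norm_le_of_abs_le fun i => ?_
      simpa using Set.abs_sub_left_of_mem_uIcc (hu.1 i)
  obtain ⟨v, hv, hmin⟩ := hTc.exists_isMinOn ⟨w, fun i => right_mem_uIcc, rfl⟩
    (f := fun u => ∑ i, |u i|) (by fun_prop)
  refine ⟨v, hv.1, hv.2, ?_⟩
  have hvs : ∀ i, v i = (SignType.sign (v i) : ℝ) * |v i| := fun i => (sign_mul_abs _).symm
  have key := hC (fun i => SignType.sign (v i)) ?_ v hvs
  · rw [hv.2] at key
    refine key.trans (mul_le_mul_of_nonneg_right ?_ (norm_nonneg _))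
    exact (hM ⟨_, rfl⟩).trans (le_max_left _ _)
  intro u hu hAu
  by_contra hu0
  have hev : ∀ᶠ ε : ℝ in 𝓝[>] 0, ∀ i, ε * |u i| ≤ |v i| := by
    rw [eventually_all]
    intro i
    by_cases hvi : v i = 0
    · have : u i = 0 := by rw [hu i]; simp [hvi]
      simp [this]
    · have ht : Tendsto (fun ε : ℝ => ε * |u i|) (𝓝[>] 0) (𝓝 (0 * |u i|)) :=
        (tendsto_id.mono_left nhdsWithin_le_nhds).mul_const _
      rw [zero_mul] at ht
      exact (ht.eventually (gt_mem_nhds (abs_pos.2 hvi))).mono fun _ h => h.le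
  obtain ⟨ε, hε, hε0⟩ := (hev.and self_mem_nhdsWithin).exists
  have hε0 : 0 < ε := hε0
  have hform : ∀ i, (v - ε • u) i = (SignType.sign (v i) : ℝ) * (|v i| - ε * |u i|) := by
    intro i
    have h1 := hu i
    have h2 := hvs i
    simp only [PiLp.sub_apply, PiLp.smul_apply, smul_eq_mul]
    linear_combination h2 - ε * h1
  have hsgn : ∀ i, |(v - ε • u) i| = |v i| - ε * |u i| := by
    intro i
    rw [hform]
    rcases eq_or_ne (v i) 0 with h | h
    · have : u i = 0 := by rw [hu i]; simp [h]
      simp [h, this]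
    · rw [abs_mul, abs_of_nonneg (sub_nonneg.2 (hε i))]
      rcases lt_or_gt_of_ne h with h' | h' <;> simp [sign_neg, sign_pos, h']
  have hmem : v - ε • u ∈ T := by
    refine ⟨fun i => ?_, by simp [hAu, hv.2]⟩
    have h1 := hform i
    have h2 := hε i
    have h3 : 0 ≤ ε * |u i| := by positivity
    have h4 := hv.1 i
    rw [Set.mem_uIcc] at h4 ⊢
    rcases lt_trichotomy (v i) 0 with h | h | h
    · simp only [sign_neg h, abs_of_neg h, SignType.coe_neg_one] at h1 h2
      right
      rcases h4 with h4 | h4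
      · linarith [h4.1]
      · constructor <;> linarith [h4.1]
    · simp only [h, sign_zero, SignType.coe_zero, zero_mul] at h1
      rw [h1]
      rcases le_total 0 (w i) with h5 | h5
      · exact Or.inl ⟨le_rfl, h5⟩
      · exact Or.inr ⟨h5, le_rfl⟩
    · simp only [sign_pos h, abs_of_pos h, SignType.coe_one] at h1 h2
      left
      rcases h4 with h4 | h4
      · constructor <;> linarith [h4.1, h4.2]
      · linarith [h4.2]
  have hle : ∑ i, |v i| ≤ ∑ i, |(v - ε • u) i| := hmin hmem
  simp only [hsgn, Finset.sum_sub_distrib, ← Finset.mul_sum] at hle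
  have hpos : 0 < ∑ i, |u i| := (norm_pos_iff.2 hu0).trans_le (euclidean_norm_le_sum_abs u)
  have := mul_pos hε0 hpos
  linarith

/-- The gradient of the Lagrangian, written through the gradients of its ingredients. -/
def gradG {n m : ℕ} (φ : En n → ℝ) (g : Fin m → En n → ℝ) (l : En m) (z : En n) : En n :=
  gradient φ z + ∑ i, l i • gradient (g i) z

theorem gradL_eq_gradG {n m : ℕ} {φ : En n → ℝ} {g : Fin m → En n → ℝ} {z : En n}
    (hφ : DifferentiableAt ℝ φ z) (hg : ∀ i, DifferentiableAt ℝ (g i) z) (l : En m) :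
    gradL φ g l z = gradG φ g l z := by
  have h : HasFDerivAt (fun z' => Lagr φ g z' l)
      (fderiv ℝ φ z + ∑ i, l i • fderiv ℝ (g i) z) z :=
    hφ.hasFDerivAt.add (HasFDerivAt.fun_sum fun i _ => (hg i).hasFDerivAt.const_mul (l i))
  simp only [gradL, gradG, gradient, h.fderiv, map_add, map_sum]
  congr 1
  refine Finset.sum_congr rfl fun i _ => ?_
  rw [map_smulₛₗ]
  simp

theorem Smooth2.contDiffAt {n m : ℕ} {φ : En n → ℝ} {g : Fin m → En n → ℝ} {zs : En n}
    (h : Smooth2 φ g zs) : ContDiffAt ℝ 2 φ zs ∧ ∀ i, ContDiffAt ℝ 2 (g i) zs := by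
  obtain ⟨U, hU, h1, h2, -⟩ := h
  exact ⟨h1.contDiffAt hU, fun i => (h2 i).contDiffAt hU⟩

theorem ContDiffAt.differentiableAt_gradient {n : ℕ} {f : En n → ℝ} {z : En n}
    (h : ContDiffAt ℝ 2 f z) : DifferentiableAt ℝ (gradient f) z := by
  have h1 : DifferentiableAt ℝ (fderiv ℝ f) z :=
    (h.fderiv_right (m := 1) (by norm_num)).differentiableAt (by norm_num)
  exact ((InnerProductSpace.toDual ℝ (En n)).symm.toContinuousLinearEquiv.differentiableAt).comp
    z h1

section Regularity

variable {n m : ℕ} {φ : En n → ℝ} {g : Fin m → En n → ℝ} {zs : En n}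

theorem Smooth2.eventually_gradL_eq (h : Smooth2 φ g zs) :
    ∀ᶠ z in 𝓝 zs, ∀ l, gradL φ g l z = gradG φ g l z := by
  have h1 := h.contDiffAt.1.eventually (by simp)
  have h2 : ∀ᶠ z in 𝓝 zs, ∀ i, ContDiffAt ℝ 2 (g i) z :=
    eventually_all.2 fun i => (h.contDiffAt.2 i).eventually (by simp)
  filter_upwards [h1, h2] with z hz1 hz2 l
  exact gradL_eq_gradG (hz1.differentiableAt (by norm_num))
    (fun i => (hz2 i).differentiableAt (by norm_num)) l

theorem Smooth2.hasGradientAt (h : Smooth2 φ g zs) (i : Fin m) :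
    HasGradientAt (g i) (gradient (g i) zs) zs :=
  ((h.contDiffAt.2 i).differentiableAt (by norm_num)).hasGradientAt

theorem Smooth2.hasFDerivAt_gradient (h : Smooth2 φ g zs) :
    HasFDerivAt (gradient φ) (fderiv ℝ (gradient φ) zs) zs ∧
      ∀ i, HasFDerivAt (gradient (g i)) (fderiv ℝ (gradient (g i)) zs) zs :=
  ⟨h.contDiffAt.1.differentiableAt_gradient.hasFDerivAt,
    fun i => (h.contDiffAt.2 i).differentiableAt_gradient.hasFDerivAt⟩

theorem Smooth2.hessL_eq (h : Smooth2 φ g zs) (l : En m) :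
    hessL φ g l zs =
      fderiv ℝ (gradient φ) zs + ∑ i, l i • fderiv ℝ (gradient (g i)) zs := by
  have h1 : gradL φ g l =ᶠ[𝓝 zs] gradG φ g l := h.eventually_gradL_eq.mono fun z hz => hz l
  have h2 : HasFDerivAt (gradG φ g l)
      (fderiv ℝ (gradient φ) zs + ∑ i, l i • fderiv ℝ (gradient (g i)) zs) zs :=
    h.hasFDerivAt_gradient.1.add
      (HasFDerivAt.fun_sum fun i _ => (h.hasFDerivAt_gradient.2 i).const_smul (l i))
  rw [hessL, h1.fderiv_eq, h2.fderiv]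

theorem Smooth2.mem_Slam_iff (h : Smooth2 φ g zs) {l : En m} :
    l ∈ Slam φ g zs ↔ gradG φ g l zs = 0 ∧ (∀ i, g i zs ≤ 0) ∧ (∀ i, 0 ≤ l i) ∧
      ∀ i, g i zs ≠ 0 → l i = 0 := by
  have h1 := h.eventually_gradL_eq.self_of_nhds l
  simp only [Slam, KKTat, Set.mem_ofPred_eq, h1]
  refine and_congr_right fun _ => and_congr_right fun hg => and_congr_right fun hl => ?_
  rw [Finset.sum_eq_zero_iff_of_nonpos fun i _ => mul_nonpos_of_nonneg_of_nonpos (hl i) (hg i)]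
  refine ⟨fun h i hi => ?_, fun h i _ => ?_⟩
  · exact (mul_eq_zero.1 (h i (Finset.mem_univ i))).resolve_right hi
  · by_cases hi : g i zs = 0
    · simp [hi]
    · simp [h i hi]

theorem continuous_gradG_left (z : En n) : Continuous fun l : En m => gradG φ g l z := by
  unfold gradG
  fun_prop

theorem Smooth2.isClosed_Slam (h : Smooth2 φ g zs) : IsClosed (Slam φ g zs) := by
  have hco : ∀ i, Continuous fun u : En m => u i := fun i => by fun_prop
  have he : Slam φ g zs = {l : En m | gradG φ g l zs = 0} ∩ ({_l : En m | ∀ i, g i zs ≤ 0} ∩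
      ((⋂ i, {l : En m | 0 ≤ l i}) ∩ ⋂ i, {l : En m | g i zs ≠ 0 → l i = 0})) := by
    ext l
    rw [h.mem_Slam_iff]
    simp
  rw [he]
  refine (isClosed_eq (continuous_gradG_left zs) continuous_const).inter (isClosed_const.inter
    ((isClosed_iInter fun i => isClosed_le continuous_const (hco i)).inter
      (isClosed_iInter fun i => ?_)))
  by_cases hi : g i zs = 0
  · simp [hi]
  · simpa [hi] using isClosed_eq (hco i) continuous_const

/-- The Mangasarian–Fromovitz condition bounds the multipliers. -/
theorem MFCQ.exists_norm_le (hM : MFCQ g zs) (h : Smooth2 φ g zs) :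
    ∃ R : ℝ, ∀ l ∈ Slam φ g zs, ‖l‖ ≤ R := by
  obtain ⟨y, hy⟩ := hM
  set a : Fin m → ℝ := fun i => ⟪gradient (g i) zs, y⟫ with ha
  set b : ℝ := ⟪gradient φ zs, y⟫ with hb
  refine ⟨∑ i, |b / a i|, fun l hl => ?_⟩
  obtain ⟨h1, -, h3, h4⟩ := h.mem_Slam_iff.1 hl
  refine (euclidean_norm_le_sum_abs l).trans (Finset.sum_le_sum fun j _ => ?_)
  by_cases hj : g j zs = 0
  · have haj : a j < 0 := hy j hj
    have hsum : b + ∑ i, l i * a i = 0 := by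
      have := congrArg (fun v => ⟪v, y⟫) h1
      simpa [gradG, inner_add_left, sum_inner, inner_smul_left, ha, hb] using this
    have hle : ∑ i, l i * a i ≤ l j * a j := by
      have hnp : ∀ i, l i * a i ≤ 0 := fun i => by
        by_cases hi : g i zs = 0
        · exact mul_nonpos_of_nonneg_of_nonpos (h3 i) (hy i hi).le
        · simp [h4 i hi]
      rw [← Finset.add_sum_erase _ _ (Finset.mem_univ j)]
      have := Finset.sum_nonpos fun i (_ : i ∈ Finset.univ.erase j) => hnp i
      linarith
    have hb0 : 0 ≤ b := by
      have := mul_nonpos_of_nonneg_of_nonpos (h3 j) haj.le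
      have : ∑ i, l i * a i ≤ 0 := hle.trans this
      linarith
    rw [abs_div, abs_of_nonneg (h3 j), abs_of_nonneg hb0, abs_of_neg haj,
      le_div_iff₀ (neg_pos.2 haj)]
    linarith
  · rw [h4 j hj, abs_zero]
    exact abs_nonneg _

end Regularity

theorem HasFDerivAt.tendsto_normalized {ι E F : Type*} [NormedAddCommGroup E] [NormedSpace ℝ E]
    [NormedAddCommGroup F] [NormedSpace ℝ F] {f : E → F} {f' : E →L[ℝ] F} {x d : E}
    (h : HasFDerivAt f f' x) {U : Filter ι} {z : ι → E} (hz : Tendsto z U (𝓝 x))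
    (hd : Tendsto (fun k => ‖z k - x‖⁻¹ • (z k - x)) U (𝓝 d)) :
    Tendsto (fun k => ‖z k - x‖⁻¹ • (f (z k) - f x)) U (𝓝 (f' d)) := by
  have h1 : Tendsto (fun k => ‖z k - x‖⁻¹ • (f (z k) - f x - f' (z k - x))) U (𝓝 0) := by
    have := (h.isLittleO.comp_tendsto hz).norm_norm.tendsto_div_nhds_zero
    rw [tendsto_zero_iff_norm_tendsto_zero]
    refine this.congr fun k => ?_
    simp [norm_smul, div_eq_inv_mul]
  have h2 := h1.add ((f'.continuous.tendsto d).comp hd)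
  rw [zero_add] at h2
  refine h2.congr fun k => ?_
  simp only [Function.comp_apply, map_smul]
  rw [← smul_add, sub_add_cancel]

section ErrorBound

variable {n m : ℕ} {φ : En n → ℝ} {g : Fin m → En n → ℝ} {zs : En n}

theorem eta_nonneg (z : En n) (l : En m) : 0 ≤ eta φ g z l := Real.sqrt_nonneg _

theorem norm_gradL_le_eta (z : En n) (l : En m) : ‖gradL φ g l z‖ ≤ eta φ g z l :=
  Real.le_sqrt_of_sq_le (le_add_of_nonneg_right (Finset.sum_nonneg fun _ _ => sq_nonneg _))

theorem abs_min_le_eta (z : En n) (l : En m) (i : Fin m) :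
    |min (l i) (-(g i z))| ≤ eta φ g z l := by
  refine Real.le_sqrt_of_sq_le ?_
  rw [sq_abs]
  have := Finset.single_le_sum (f := fun i => (min (l i) (-(g i z))) ^ 2)
    (fun _ _ => sq_nonneg _) (Finset.mem_univ i)
  exact this.trans (le_add_of_nonneg_left (sq_nonneg _))

theorem Smooth2.tendsto_eta (h : Smooth2 φ g zs) {p : En m} (hp : p ∈ Slam φ g zs) :
    Tendsto (fun x : En n × En m => eta φ g x.1 x.2) (𝓝 (zs, p)) (𝓝 0) := by
  obtain ⟨h1, h2, h3, h4⟩ := h.mem_Slam_iff.1 hp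
  have hz : Tendsto (fun x : En n × En m => x.1) (𝓝 (zs, p)) (𝓝 zs) := continuous_fst.tendsto _
  have hl : ∀ i, Tendsto (fun x : En n × En m => x.2 i) (𝓝 (zs, p)) (𝓝 (p i)) := fun i =>
    (by fun_prop : Continuous fun x : En n × En m => x.2 i).tendsto (zs, p)
  have hG : Tendsto (fun x : En n × En m => gradG φ g x.2 x.1) (𝓝 (zs, p)) (𝓝 0) := by
    rw [← h1]
    exact (h.hasFDerivAt_gradient.1.continuousAt.tendsto.comp hz).add (tendsto_finsetSum _
      fun i _ => (hl i).smul ((h.hasFDerivAt_gradient.2 i).continuousAt.tendsto.comp hz))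
  have hmin : ∀ i, Tendsto (fun x : En n × En m => min (x.2 i) (-(g i x.1))) (𝓝 (zs, p))
      (𝓝 0) := by
    intro i
    have := (hl i).min ((h.hasGradientAt i).continuousAt.tendsto.comp hz).neg
    have hv : min (p i) (-(g i zs)) = 0 := by
      by_cases hi : g i zs = 0
      · simp [hi, h3 i]
      · simp [h4 i hi, h2 i]
    rw [hv] at this
    exact this
  have hs := ((hG.norm.pow 2).add (tendsto_finsetSum Finset.univ
    fun i _ => (hmin i).pow 2)).sqrt
  simp only [norm_zero, ne_eq, OfNat.ofNat_ne_zero, not_false_eq_true, zero_pow,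
    Finset.sum_const_zero, add_zero, Real.sqrt_zero] at hs
  refine hs.congr' ?_
  filter_upwards [hz.eventually h.eventually_gradL_eq] with x hx
  rw [eta, hx]

theorem Smooth2.exists_norm_gradG_sub_le (h : Smooth2 φ g zs) :
    ∃ K : ℝ, 0 ≤ K ∧ ∀ᶠ z in 𝓝 zs, ∀ l : En m,
      ‖gradG φ g l z - gradG φ g l zs‖ ≤ K * (1 + ‖l‖) * ‖z - zs‖ := by
  obtain ⟨K₀, hK₀, h0⟩ := h.hasFDerivAt_gradient.1.isBigO_sub.exists_nonneg
  choose K hK hi using fun i => (h.hasFDerivAt_gradient.2 i).isBigO_sub.exists_nonneg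
  refine ⟨K₀ + ∑ i, K i, add_nonneg hK₀ (Finset.sum_nonneg fun i _ => hK i), ?_⟩
  filter_upwards [h0.bound, eventually_all.2 fun i => (hi i).bound] with z hz0 hzi l
  have hsub : gradG φ g l z - gradG φ g l zs = (gradient φ z - gradient φ zs) +
      ∑ i, l i • (gradient (g i) z - gradient (g i) zs) := by
    simp only [gradG, smul_sub, Finset.sum_sub_distrib]
    abel
  have hsum : ‖∑ i, l i • (gradient (g i) z - gradient (g i) zs)‖ ≤
      (∑ i, K i) * ‖l‖ * ‖z - zs‖ := by
    rw [Finset.sum_mul, Finset.sum_mul]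
    refine (norm_sum_le _ _).trans (Finset.sum_le_sum fun i _ => ?_)
    rw [norm_smul, mul_comm (K i), mul_assoc]
    exact mul_le_mul (PiLp.norm_apply_le l i) (hzi i) (norm_nonneg _) (norm_nonneg _)
  rw [hsub]
  refine (norm_add_le _ _).trans ((add_le_add hz0 hsum).trans ?_)
  have h5 : 0 ≤ K₀ * ‖l‖ * ‖z - zs‖ := by positivity
  have h6 : 0 ≤ (∑ i, K i) * ‖z - zs‖ :=
    mul_nonneg (Finset.sum_nonneg fun i _ => hK i) (norm_nonneg _)
  linarith

/-- Hoffman-type bound for the distance to the multiplier set. -/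
theorem Smooth2.exists_norm_sub_multiplier_le (h : Smooth2 φ g zs) {p : En m}
    (hp : p ∈ Slam φ g zs) :
    ∃ C : ℝ, 0 ≤ C ∧ ∀ᶠ x : En n × En m in 𝓝 (zs, p), ∃ r ∈ Slam φ g zs,
      ‖x.2 - r‖ ≤ C * (‖x.1 - zs‖ + eta φ g x.1 x.2) := by
  obtain ⟨hp1, hp2, hp3, hp4⟩ := h.mem_Slam_iff.1 hp
  let A : En m →L[ℝ] En n :=
    LinearMap.toContinuousLinearMap
      { toFun := fun l => ∑ i, l i • gradient (g i) zs
        map_add' := fun x y => by simp [add_smul, Finset.sum_add_distrib]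
        map_smul' := fun c x => by simp [mul_smul, Finset.smul_sum] }
  have hA : ∀ l : En m, A l = ∑ i, l i • gradient (g i) zs := fun l => rfl
  have hGA : ∀ l l' : En m, A (l - l') = gradG φ g l zs - gradG φ g l' zs := by
    intro l l'
    rw [map_sub, hA, hA, gradG, gradG, add_sub_add_left_eq_sub]
  obtain ⟨C, hC0, hC⟩ := exists_conformal_norm_le A
  obtain ⟨K, hK0, hK⟩ := h.exists_norm_gradG_sub_le
  have hz : Tendsto (fun x : En n × En m => x.1) (𝓝 (zs, p)) (𝓝 zs) := continuous_fst.tendsto _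
  have hl : Tendsto (fun x : En n × En m => x.2) (𝓝 (zs, p)) (𝓝 p) := continuous_snd.tendsto _
  have hinact : ∀ᶠ x : En n × En m in 𝓝 (zs, p), ∀ i, g i zs ≠ 0 →
      eta φ g x.1 x.2 < -(g i x.1) := by
    refine eventually_all.2 fun i => ?_
    by_cases hi : g i zs = 0
    · simp [hi]
    · have hlt : 0 < -(g i zs) := neg_pos.2 (lt_of_le_of_ne (hp2 i) hi)
      exact ((h.tendsto_eta hp).eventually_lt
        ((h.hasGradientAt i).continuousAt.tendsto.comp hz).neg hlt).mono fun x hx _ => hx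
  have hbd : ∀ᶠ x : En n × En m in 𝓝 (zs, p), ‖x.2‖ < ‖p‖ + 1 :=
    hl.norm.eventually (gt_mem_nhds (lt_add_one _))
  refine ⟨m + C * (1 + ‖A‖ * m + K * (2 + ‖p‖)), by positivity, ?_⟩
  filter_upwards [hinact, hbd, hz.eventually hK, hz.eventually h.eventually_gradL_eq]
    with ⟨z, l⟩ hin hb hKz hgr
  simp only at hin hb hKz hgr ⊢
  set e := eta φ g z l with he
  have he0 : 0 ≤ e := eta_nonneg z l
  have hmin : ∀ i, |min (l i) (-(g i z))| ≤ e := abs_min_le_eta (φ := φ) z l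
  classical
  let x : En m := WithLp.toLp 2 fun i => if g i zs = 0 then max (l i) 0 else 0
  have hx : ∀ i, x i = if g i zs = 0 then max (l i) 0 else 0 := fun i => rfl
  have hlx : ‖l - x‖ ≤ m * e := by
    have : ∀ i, |(l - x) i| ≤ e := by
      intro i
      have h1 := abs_le.1 (hmin i)
      rw [PiLp.sub_apply, hx]
      split_ifs with hi
      · rcases le_total (l i) 0 with h2 | h2
        · rw [max_eq_right h2, sub_zero, abs_of_nonpos h2]
          linarith [min_le_left (l i) (-(g i z))]
        · simp [max_eq_left h2, he0]
      · rcases le_total (l i) (-(g i z)) with h2 | h2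
        · simpa [min_eq_left h2] using hmin i
        · rw [min_eq_right h2] at h1
          linarith [hin i hi]
    refine (euclidean_norm_le_sum_abs _).trans ((Finset.sum_le_sum fun i _ => this i).trans ?_)
    simp
  obtain ⟨w, hw1, hw2, hw3⟩ := hC (p - x)
  have hAx : ‖A (p - x)‖ ≤ e + K * (2 + ‖p‖) * ‖z - zs‖ + ‖A‖ * (m * e) := by
    have e1 : A (p - x) =
        A (l - x) + (gradG φ g l z - gradG φ g l zs) - gradG φ g l z := by
      rw [hGA, hGA, hp1]
      abel
    rw [e1]
    refine (norm_sub_le _ _).trans ((add_le_add (norm_add_le _ _) le_rfl).trans ?_)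
    have e2 : ‖A (l - x)‖ ≤ ‖A‖ * (m * e) :=
      (A.le_opNorm _).trans (mul_le_mul_of_nonneg_left hlx (norm_nonneg _))
    have e3 : ‖gradG φ g l z‖ ≤ e := by
      rw [← hgr]
      exact norm_gradL_le_eta z l
    have e4 : K * (1 + ‖l‖) * ‖z - zs‖ ≤ K * (2 + ‖p‖) * ‖z - zs‖ :=
      mul_le_mul_of_nonneg_right (mul_le_mul_of_nonneg_left (by linarith) hK0) (norm_nonneg _)
    linarith [hKz l]
  have hxw : ∀ i, 0 ≤ (x + w) i ∧ (g i zs ≠ 0 → (x + w) i = 0) := by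
    intro i
    have h1 := hw1 i
    have h2 := hp3 i
    have h3 := hx i
    simp only [PiLp.sub_apply, PiLp.add_apply, Set.mem_uIcc] at h1 ⊢
    have hx0 : 0 ≤ x i := by
      rw [h3]
      split_ifs <;> simp
    refine ⟨?_, fun hi => ?_⟩
    · rcases h1 with h1 | h1 <;> linarith [h1.1]
    · rw [if_neg hi] at h3
      rw [h3, hp4 i hi] at h1
      rw [h3]
      rcases h1 with h1 | h1 <;> linarith [h1.1, h1.2]
  refine ⟨x + w, h.mem_Slam_iff.2 ⟨?_, hp2, fun i => (hxw i).1, fun i => (hxw i).2⟩, ?_⟩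
  · have e1 := hGA p (x + w)
    have e2 : A (p - (x + w)) = 0 := by
      rw [← sub_sub, map_sub, hw2, sub_self]
    rw [hp1, e2, zero_sub] at e1
    exact neg_eq_zero.1 e1.symm
  · rw [← sub_sub]
    refine (norm_sub_le _ _).trans ?_
    have e1 := mul_le_mul_of_nonneg_left hAx hC0
    have e2 : 0 ≤ (m : ℝ) * ‖z - zs‖ := by positivity
    have e3 : 0 ≤ C * (1 + ‖A‖ * m) * ‖z - zs‖ := by positivity
    have e4 : 0 ≤ C * (K * (2 + ‖p‖)) * e := by positivity
    linarith


/-- A unit direction along which the residual is of lower order, together with a limiting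
normalized multiplier displacement, contradicts the second-order condition. -/
theorem SOC.false_of_limit (hS : SOC φ g zs) (h : Smooth2 φ g zs) {p : En m}
    (hp : p ∈ Slam φ g zs) {d : En n} (hd : ‖d‖ = 1) {q : En m}
    (hHd : hessL φ g p zs d + ∑ i, q i • gradient (g i) zs = 0)
    (hnonpos : ∀ i, g i zs = 0 → ⟪gradient (g i) zs, d⟫ ≤ 0)
    (hinact : ∀ i, g i zs ≠ 0 → q i = 0)
    (hneg : ∀ i, g i zs = 0 → ⟪gradient (g i) zs, d⟫ < 0 → p i = 0 ∧ q i ≤ 0) : False := by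
  set γ : Fin m → ℝ := fun i => ⟪gradient (g i) zs, d⟫ with hγ
  have hcompl : ∀ i, p i * γ i = 0 := by
    intro i
    by_cases hi : g i zs = 0
    · rcases (hnonpos i hi).lt_or_eq with h1 | h1
      · rw [(hneg i hi h1).1, zero_mul]
      · rw [hγ]
        simp only
        rw [h1, mul_zero]
    · rw [(h.mem_Slam_iff.1 hp).2.2.2 i hi, zero_mul]
  have hstat : ∀ l ∈ Slam φ g zs, ⟪gradient φ zs, d⟫ + ∑ i, l i * γ i = 0 := by
    intro l hl
    have := congrArg (fun v => ⟪v, d⟫) (h.mem_Slam_iff.1 hl).1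
    simpa [gradG, inner_add_left, sum_inner, inner_smul_left, hγ] using this
  obtain ⟨σ, hσ, hsoc⟩ := hS
  have hcrit : ∀ i ∈ Bplus φ g zs, ⟪gradient (g i) zs, d⟫ = 0 := by
    rintro j ⟨hj, l, hl, hlj⟩
    have h1 := hstat p hp
    have h2 := hstat l hl
    rw [Finset.sum_eq_zero fun i _ => hcompl i, add_zero] at h1
    rw [h1, zero_add] at h2
    obtain ⟨-, -, hl0, hl1⟩ := h.mem_Slam_iff.1 hl
    rw [Finset.sum_eq_zero_iff_of_nonpos] at h2
    · exact (mul_eq_zero.1 (h2 j (Finset.mem_univ j))).resolve_left hlj.ne'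
    · intro i _
      by_cases hi : g i zs = 0
      · exact mul_nonpos_of_nonneg_of_nonpos (hl0 i) (hnonpos i hi)
      · rw [hl1 i hi, zero_mul]
  have hquad := hsoc p hp d hcrit fun i hi => hnonpos i hi.1
  have hsum : ⟪d, hessL φ g p zs d⟫ + ∑ i, q i * γ i = 0 := by
    have := congrArg (fun v => ⟪d, v⟫) hHd
    simp only [inner_add_right, inner_sum, inner_smul_right, inner_zero_right] at this
    rw [← this]
    congr 1
    exact Finset.sum_congr rfl fun i _ => by rw [hγ, real_inner_comm]
  have hqγ : 0 ≤ ∑ i, q i * γ i := by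
    refine Finset.sum_nonneg fun i _ => ?_
    by_cases hi : g i zs = 0
    · rcases (hnonpos i hi).lt_or_eq with h1 | h1
      · exact mul_nonneg_of_nonpos_of_nonpos (hneg i hi h1).2 h1.le
      · exact (mul_eq_zero_of_right _ h1).ge
    · rw [hinact i hi, zero_mul]
  rw [hd] at hquad
  linarith

theorem Ultrafilter.exists_tendsto_of_eventually_mem {ι X : Type*} [TopologicalSpace X]
    {s : Set X} (hs : IsCompact s) (U : Ultrafilter ι) {f : ι → X} (hf : ∀ᶠ k in U, f k ∈ s) :
    ∃ a ∈ s, Tendsto f U (𝓝 a) :=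
  hs.ultrafilter_le_nhds (U.map f) (le_principal_iff.2 hf)

/-- The residual bounds the primal distance near a primal-dual solution. -/
theorem AssumpA.exists_norm_sub_le_eta (hA : AssumpA φ g zs) {p : En m}
    (hp : p ∈ Slam φ g zs) :
    ∃ C : ℝ, ∀ᶠ x : En n × En m in 𝓝 (zs, p), ‖x.1 - zs‖ ≤ C * eta φ g x.1 x.2 := by
  obtain ⟨h, -, -, hS⟩ := hA
  obtain ⟨-, hp2, -, hp4⟩ := h.mem_Slam_iff.1 hp
  by_contra! hcon
  obtain ⟨C, hC0, hC⟩ := h.exists_norm_sub_multiplier_le hp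
  have hseq : ∀ k : ℕ, ∃ x : En n × En m, ∃ r ∈ Slam φ g zs,
      dist x (zs, p) < 1 / ((k : ℝ) + 1) ∧
      ((k : ℝ) + 1) * eta φ g x.1 x.2 < ‖x.1 - zs‖ ∧
      ‖x.2 - r‖ ≤ C * (‖x.1 - zs‖ + eta φ g x.1 x.2) := by
    intro k
    obtain ⟨x, hx1, hx2, r, hr, hxr⟩ := ((hcon ((k : ℝ) + 1)).and_eventually
      ((Metric.eventually_nhds_iff_ball.2 ⟨1 / ((k : ℝ) + 1), by positivity, fun _ h => h⟩ :
        ∀ᶠ x in 𝓝 (zs, p), dist x (zs, p) < 1 / ((k : ℝ) + 1)).and hC)).exists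
    exact ⟨x, r, hr, hx2, hx1, hxr⟩
  choose x r hr hdist hlt hxr using hseq
  set U : Ultrafilter ℕ := hyperfilter ℕ
  have hUle : (U : Filter ℕ) ≤ atTop := by
    rw [← Nat.cofinite_eq_atTop]
    exact hyperfilter_le_cofinite
  have hone : Tendsto (fun k : ℕ => 1 / ((k : ℝ) + 1)) U (𝓝 0) :=
    tendsto_one_div_add_atTop_nhds_zero_nat.mono_left hUle
  have hx : Tendsto x U (𝓝 (zs, p)) :=
    tendsto_iff_dist_tendsto_zero.2
      (squeeze_zero (fun _ => dist_nonneg) (fun k => (hdist k).le) hone)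
  have hz : Tendsto (fun k => (x k).1) U (𝓝 zs) := (continuous_fst.tendsto _).comp hx
  have hl : Tendsto (fun k => (x k).2) U (𝓝 p) := (continuous_snd.tendsto _).comp hx
  set t : ℕ → ℝ := fun k => ‖(x k).1 - zs‖ with ht
  set e : ℕ → ℝ := fun k => eta φ g (x k).1 (x k).2 with he
  have he0 : ∀ k, 0 ≤ e k := fun k => eta_nonneg _ _
  have ht0 : ∀ k, 0 < t k := fun k =>
    (mul_nonneg (by positivity) (he0 k)).trans_lt (hlt k)
  have hti0 : ∀ k, 0 ≤ (t k)⁻¹ := fun k => (inv_pos.2 (ht0 k)).le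
  have htlim : Tendsto t U (𝓝 0) := by
    have := (hz.sub_const zs).norm
    rwa [sub_self, norm_zero] at this
  have hetle : ∀ k, (t k)⁻¹ * e k ≤ 1 / ((k : ℝ) + 1) := by
    intro k
    rw [inv_mul_le_iff₀ (ht0 k), mul_one_div, le_div_iff₀ (by positivity)]
    linarith [hlt k]
  have het : Tendsto (fun k => (t k)⁻¹ * e k) U (𝓝 0) :=
    squeeze_zero (fun k => mul_nonneg (hti0 k) (he0 k)) hetle hone
  obtain ⟨d, hd, hdlim⟩ := U.exists_tendsto_of_eventually_mem
    (isCompact_sphere (0 : En n) 1) (f := fun k => (t k)⁻¹ • ((x k).1 - zs))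
    (Eventually.of_forall fun k => by
      rw [mem_sphere_zero_iff_norm, norm_smul, norm_inv, Real.norm_of_nonneg (ht0 k).le]
      exact inv_mul_cancel₀ (ht0 k).ne')
  obtain ⟨q, -, hqlim⟩ := U.exists_tendsto_of_eventually_mem
    (isCompact_closedBall (0 : En m) (2 * C)) (f := fun k => (t k)⁻¹ • ((x k).2 - r k))
    (Eventually.of_forall fun k => by
      rw [mem_closedBall_zero_iff, norm_smul, norm_inv, Real.norm_of_nonneg (ht0 k).le,
        inv_mul_le_iff₀ (ht0 k)]
      refine (hxr k).trans ?_
      have h1 : e k ≤ t k := by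
        have h2 := hlt k
        have h3 : 0 ≤ (k : ℝ) * e k := mul_nonneg (Nat.cast_nonneg k) (he0 k)
        change ((k : ℝ) + 1) * e k < t k at h2
        linarith
      have := mul_le_mul_of_nonneg_left (add_le_add_right h1 (t k)) hC0
      change C * (t k + e k) ≤ _
      linarith)
  have hli : ∀ i, Tendsto (fun k => (x k).2 i) U (𝓝 (p i)) := fun i =>
    ((by fun_prop : Continuous fun u : En m => u i).tendsto p).comp hl
  have hqi : ∀ i, Tendsto (fun k => (t k)⁻¹ * ((x k).2 i - r k i)) U (𝓝 (q i)) := fun i =>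
    ((by fun_prop : Continuous fun u : En m => u i).tendsto q).comp hqlim
  have hgi : ∀ i, g i zs = 0 →
      Tendsto (fun k => (t k)⁻¹ * g i (x k).1) U (𝓝 ⟪gradient (g i) zs, d⟫) := by
    intro i hi
    have := (h.hasGradientAt i).hasFDerivAt.tendsto_normalized hz hdlim
    simpa [hi] using this
  have hmin : ∀ i, Tendsto (fun k => (t k)⁻¹ * min ((x k).2 i) (-(g i (x k).1))) U (𝓝 0) := by
    intro i
    refine squeeze_zero_norm (fun k => ?_) het
    rw [norm_mul, Real.norm_of_nonneg (hti0 k)]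
    exact mul_le_mul_of_nonneg_left (abs_min_le_eta _ _ i) (hti0 k)
  have hrS := fun k => h.mem_Slam_iff.1 (hr k)
  have hqle : ∀ i, (∀ᶠ k in U, min ((x k).2 i) (-(g i (x k).1)) = (x k).2 i) → q i ≤ 0 := by
    intro i hi
    refine le_of_tendsto_of_tendsto (hqi i) (hmin i) ?_
    filter_upwards [hi] with k hk
    rw [hk]
    exact mul_le_mul_of_nonneg_left (by linarith [(hrS k).2.2.1 i]) (hti0 k)
  have hinact_min : ∀ i, g i zs ≠ 0 →
      ∀ᶠ k in U, min ((x k).2 i) (-(g i (x k).1)) = (x k).2 i := by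
    intro i hi
    have h1 : 0 < -(g i zs) := neg_pos.2 (lt_of_le_of_ne (hp2 i) hi)
    have h2 := (hli i).eventually_lt ((h.hasGradientAt i).continuousAt.tendsto.comp hz).neg
      (by rw [hp4 i hi]; exact h1)
    exact h2.mono fun k hk => min_eq_left hk.le
  refine hS.false_of_limit h hp (mem_sphere_zero_iff_norm.1 hd) (q := q) ?_ ?_ ?_ ?_
  · have hG0 : Tendsto (fun k => (t k)⁻¹ • gradG φ g (x k).2 (x k).1) U (𝓝 0) := by
      refine squeeze_zero_norm' ?_ het
      filter_upwards [hz.eventually h.eventually_gradL_eq] with k hk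
      rw [← hk, norm_smul, Real.norm_of_nonneg (hti0 k)]
      exact mul_le_mul_of_nonneg_left (norm_gradL_le_eta _ _) (hti0 k)
    refine tendsto_nhds_unique ?_ hG0
    have h1 := (h.hasFDerivAt_gradient.1.tendsto_normalized hz hdlim).add
      (tendsto_finsetSum Finset.univ fun i _ =>
        (hli i).smul ((h.hasFDerivAt_gradient.2 i).tendsto_normalized hz hdlim))
    have h2 := h1.add (tendsto_finsetSum Finset.univ fun i _ =>
      (hqi i).smul_const (gradient (g i) zs))
    have h3 : hessL φ g p zs d = fderiv ℝ (gradient φ) zs d +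
        ∑ i, p i • fderiv ℝ (gradient (g i)) zs d := by
      rw [h.hessL_eq]
      simp
    rw [h3]
    refine h2.congr fun k => ?_
    have h4 := (hrS k).1
    rw [gradG, add_eq_zero_iff_eq_neg] at h4
    simp only [gradG, h4, smul_add, smul_sub, Finset.smul_sum, smul_smul, sub_smul, mul_sub,
      Finset.sum_sub_distrib, smul_neg, mul_comm ((x k).2 _)]
    abel
  · intro i hi
    have h1 := (hgi i hi).neg
    have h2 := le_of_tendsto_of_tendsto (hmin i) h1 (Eventually.of_forall fun k => by
      simp only [← mul_neg]
      exact mul_le_mul_of_nonneg_left (min_le_right _ _) (hti0 k))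
    linarith
  · intro i hi
    have h1 := hinact_min i hi
    refine tendsto_nhds_unique (hqi i) ((hmin i).congr' ?_)
    filter_upwards [h1] with k hk
    rw [hk, (hrS k).2.2.2 i hi, sub_zero]
  · intro i hi hneg
    have hev : ∀ᶠ k in U, min ((x k).2 i) (-(g i (x k).1)) = (x k).2 i := by
      filter_upwards [(hmin i).eventually_lt (hgi i hi).neg (neg_pos.2 hneg)] with k hk
      rw [← mul_neg] at hk
      have h1 := lt_of_mul_lt_mul_left hk (hti0 k)
      rcases min_choice ((x k).2 i) (-(g i (x k).1)) with h2 | h2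
      · exact h2
      · exact absurd h2 h1.ne
    refine ⟨?_, hqle i hev⟩
    have h1 := htlim.mul (hmin i)
    rw [zero_mul] at h1
    refine tendsto_nhds_unique (hli i) (h1.congr' ?_)
    filter_upwards [hev] with k hk
    rw [hk, mul_inv_cancel_left₀ (ht0 k).ne']


/-- A vanishing nonnegative quantity is eventually dominated by its powers of exponent below one,
even after scaling. -/
theorem Filter.Tendsto.eventually_mul_le_rpow {ι : Type*} {F : Filter ι} {u : ι → ℝ}
    (hu : Tendsto u F (𝓝 0)) (hu0 : ∀ k, 0 ≤ u k) {τ : ℝ} (hτ1 : τ < 1) (M : ℝ) :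
    ∀ᶠ k in F, M * u k ≤ u k ^ τ := by
  have h1 : Tendsto (fun k => M * u k ^ (1 - τ)) F (𝓝 0) := by
    have := (hu.rpow_const (p := 1 - τ) (Or.inr (sub_pos.2 hτ1).le)).const_mul M
    rwa [Real.zero_rpow (sub_pos.2 hτ1).ne', mul_zero] at this
  filter_upwards [h1.eventually (gt_mem_nhds one_pos)] with k hk
  have h2 : u k = u k ^ (1 - τ) * u k ^ τ := by
    rw [← Real.rpow_add' (hu0 k) (by simp), sub_add_cancel, Real.rpow_one]
  calc M * u k = M * u k ^ (1 - τ) * u k ^ τ := by rw [mul_assoc, ← h2]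
    _ ≤ 1 * u k ^ τ := mul_le_mul_of_nonneg_right hk.le (Real.rpow_nonneg (hu0 k) _)
    _ = u k ^ τ := one_mul _

/-- Near a primal-dual solution the active set is identified and every multiplier has a small
stationarity residual. -/
theorem AssumpA.eventually_identified (hA : AssumpA φ g zs) {τ : ℝ} (hτ0 : 0 < τ) (hτ1 : τ < 1)
    {p : En m} (hp : p ∈ Slam φ g zs) :
    ∀ᶠ x : En n × En m in 𝓝 (zs, p), Aest φ g τ x.1 x.2 = ActB g zs ∧
      ∀ ls ∈ Slam φ g zs, ‖gradG φ g ls x.1‖ ≤ eta φ g x.1 x.2 ^ τ := by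
  have h : Smooth2 φ g zs := hA.1
  obtain ⟨C, hC⟩ := hA.exists_norm_sub_le_eta hp
  obtain ⟨R, hR⟩ := hA.2.2.1.exists_norm_le h
  obtain ⟨K, hK0, hK⟩ := h.exists_norm_gradG_sub_le
  have hp2 := (h.mem_Slam_iff.1 hp).2.1
  have hη := h.tendsto_eta hp
  have hz : Tendsto (fun x : En n × En m => x.1) (𝓝 (zs, p)) (𝓝 zs) := continuous_fst.tendsto _
  have hpow : ∀ M, ∀ᶠ x : En n × En m in 𝓝 (zs, p),
      M * eta φ g x.1 x.2 ≤ eta φ g x.1 x.2 ^ τ :=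
    hη.eventually_mul_le_rpow (fun _ => eta_nonneg _ _) hτ1
  have hmem : ∀ i, ∀ᶠ x : En n × En m in 𝓝 (zs, p),
      i ∈ Aest φ g τ x.1 x.2 ↔ i ∈ ActB g zs := by
    intro i
    by_cases hi : g i zs = 0
    · obtain ⟨c, hc0, hc⟩ := (h.hasGradientAt i).hasFDerivAt.isBigO_sub.exists_nonneg
      filter_upwards [hz.eventually hc.bound, hC, hpow (c * C)] with x h1 h2 h3
      refine iff_of_true ?_ hi
      rw [hi, sub_zero, Real.norm_eq_abs] at h1
      have h4 := mul_le_mul_of_nonneg_left h2 hc0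
      have h5 := neg_abs_le (g i x.1)
      change -(eta φ g x.1 x.2) ^ τ ≤ g i x.1
      linarith
    · have hlt : g i zs < 0 := lt_of_le_of_ne (hp2 i) hi
      have h1 := (hη.rpow_const (p := τ) (Or.inr hτ0.le)).neg
      rw [Real.zero_rpow hτ0.ne', neg_zero] at h1
      filter_upwards [((h.hasGradientAt i).continuousAt.tendsto.comp hz).eventually_lt h1 hlt]
        with x hx
      exact iff_of_false (not_le.2 hx) hi
  filter_upwards [eventually_all.2 hmem, hC, hz.eventually hK, hpow (K * (1 + R) * C)]
    with x h1 h2 h3 h4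
  refine ⟨Set.ext h1, fun ls hls => ?_⟩
  have h5 := h3 ls
  rw [(h.mem_Slam_iff.1 hls).1, sub_zero] at h5
  have hRls := hR ls hls
  have hR0 : 0 ≤ R := (norm_nonneg ls).trans hRls
  calc ‖gradG φ g ls x.1‖ ≤ K * (1 + ‖ls‖) * ‖x.1 - zs‖ := h5
    _ ≤ K * (1 + R) * (C * eta φ g x.1 x.2) := by gcongr
    _ = K * (1 + R) * C * eta φ g x.1 x.2 := by ring
    _ ≤ _ := h4

/-- Properties holding near every point of a compact `{zs} × Slam` hold for small `deltaP`. -/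
theorem exists_forall_deltaP_le (hc : IsCompact (Slam φ g zs)) (hne : (Slam φ g zs).Nonempty)
    {P : En n × En m → Prop} (hP : ∀ p ∈ Slam φ g zs, ∀ᶠ x in 𝓝 (zs, p), P x) :
    ∃ δ' : ℝ, 0 < δ' ∧ ∀ z l, deltaP φ g zs z l ≤ δ' → P (z, l) := by
  have hcK : IsCompact (({zs} : Set (En n)) ×ˢ Slam φ g zs) := isCompact_singleton.prod hc
  have hev : ∀ᶠ x in 𝓝ˢ (({zs} : Set (En n)) ×ˢ Slam φ g zs), P x := by
    rw [eventually_nhdsSet_iff_forall]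
    rintro ⟨z, p⟩ ⟨hz, hp⟩
    obtain rfl : z = zs := hz
    exact hP p hp
  obtain ⟨ε, hε, hsub⟩ := (Metric.hasBasis_nhdsSet_thickening hcK).mem_iff.1 hev
  refine ⟨ε / 2, half_pos hε, fun z l hδ => hsub ?_⟩
  have h1 : ‖z - zs‖ ≤ ε / 2 :=
    (Real.le_sqrt_of_sq_le (le_add_of_nonneg_right (sq_nonneg _))).trans hδ
  have h2 : infDist l (Slam φ g zs) ≤ ε / 2 :=
    (Real.le_sqrt_of_sq_le (le_add_of_nonneg_left (sq_nonneg _))).trans hδ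
  obtain ⟨p, hp, hlp⟩ := (infDist_lt_iff hne).1 (h2.trans_lt (half_lt_self hε))
  refine Metric.mem_thickening_iff.2 ⟨(zs, p), ⟨rfl, hp⟩, ?_⟩
  rw [Prod.dist_eq, dist_eq_norm]
  exact max_lt (h1.trans_lt (half_lt_self hε)) hlp

end ErrorBound

/-- For (z,λ) close enough to S (so that A(z,λ) = B), every optimal multiplier λ* ∈ S_λ is
feasible for LP(Â) for every Â ⊆ A(z,λ); in particular
‖∇φ(z) + Σ_i λ*_i ∇g_i(z)‖_∞ ≤ η(z,λ)^τ. -/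
theorem stmt_18 {n m : ℕ} (φ : En n → ℝ) (g : Fin m → En n → ℝ) (zs : En n)
    (hA : AssumpA φ g zs) (τ : ℝ) (hτ0 : 0 < τ) (hτ1 : τ < 1) :
    ∃ δ' : ℝ, 0 < δ' ∧
      ∀ (z : En n) (l : En m), deltaP φ g zs z l ≤ δ' →
        Aest φ g τ z l = ActB g zs ∧
        ∀ ls ∈ Slam φ g zs,
          LPFeasible φ g τ z l ls ∧
          ∀ j : Fin n,
            |(gradient φ z + ∑ i, ls i • gradient (g i) z) j| ≤ (eta φ g z l) ^ τ := by

  have h : Smooth2 φ g zs := hA.1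
  obtain ⟨R, hR⟩ := hA.2.2.1.exists_norm_le h
  have hc : IsCompact (Slam φ g zs) := Metric.isCompact_of_isClosed_isBounded h.isClosed_Slam
    (Metric.isBounded_closedBall.subset fun l hl => mem_closedBall_zero_iff.2 (hR l hl))
  obtain ⟨δ', hδ', hP⟩ := exists_forall_deltaP_le hc hA.2.1
    fun p hp => hA.eventually_identified hτ0 hτ1 hp
  refine ⟨δ', hδ', fun z l hδ => ?_⟩
  obtain ⟨hact, hres⟩ := hP z l hδ
  refine ⟨hact, fun ls hls => ?_⟩
  obtain ⟨-, -, h3, h4⟩ := h.mem_Slam_iff.1 hls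
  have hj : ∀ j : Fin n,
      |(gradient φ z + ∑ i, ls i • gradient (g i) z) j| ≤ (eta φ g z l) ^ τ :=
    fun j => (PiLp.norm_apply_le (gradG φ g ls z) j).trans (hres ls hls)
  refine ⟨⟨hj, fun i _ => h3 i, fun i hi => h4 i ?_⟩, hj⟩
  rwa [hact] at hi
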